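/- Let q ∈ ℝ³, h₃ > 0 and set p₁ = q, p₂ = q + h₃e₃. Let a₁ ∈ ℝ³ be a point whose orthogonal projection onto the x₁x₂-plane differs from that of q, and let a₂ = a₁ + k e₃ with k > 0; set σ₁ = [p₁, a₁], σ₂ = [p₂, a₂], and let L > 0 be the length of the common orthogonal projection of σ₁ and σ₂ onto the x₁x₂-plane. Let F = conv(σ₁ ∪ σ₂) be the planar trapezoid between σ₁ and σ₂ (contained in a plane parallel to the x₃-axis). Let T = conv{p₁, p₂, p₃, p₄} be any nondegenerate tetrahedron with p₁, p₂ among its vertices, let σ₃, σ₄ be any segments of positive length in closure(T) with endpoints p₃, p₄ respectively, and define Du = (Π_{σ₁}u)(p₁)λ₁ + (Π_{σ₂}u)(p₂)λ₂ + (Π_{σ₃}u)(p₃)λ₃ + (Π_{σ₄}u)(p₄)λ₄, where λᵢ are the barycentric coordinates of T. Then for every u continuously differentiable on an open set containing T ∪ F, the constant value of ∂₃(Du) on T satisfies |∂₃(Du)| ≤ (4/(h₃ L)) ∫_F |∂₃u| dH², where dH² is the two-dimensional Hausdorff measure on F. -/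

import Mathlib

open MeasureTheory Set

theorem integral_mul_eq_zero_of_forall_integral_sq_le {α : Type*} {m : MeasurableSpace α}
    {μ : Measure α} {w v : α → ℝ} (hw : Integrable (fun x => w x ^ 2) μ)
    (hwv : Integrable (fun x => w x * v x) μ) (hv : Integrable (fun x => v x ^ 2) μ)
    (h : ∀ ε : ℝ, ∫ x, w x ^ 2 ∂μ ≤ ∫ x, (w x - ε * v x) ^ 2 ∂μ) :
    ∫ x, w x * v x ∂μ = 0 := by
  have expand (ε : ℝ) : ∫ x, (w x - ε * v x) ^ 2 ∂μ =
      ∫ x, w x ^ 2 ∂μ - 2 * ε * ∫ x, w x * v x ∂μ + ε ^ 2 * ∫ x, v x ^ 2 ∂μ := by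
    rw [← integral_const_mul, ← integral_const_mul, ← integral_sub hw (hwv.const_mul _),
      ← integral_add (f := fun x => w x ^ 2 - 2 * ε * (w x * v x))
        (hw.sub (hwv.const_mul _)) (hv.const_mul _)]
    exact integral_congr_ae (.of_forall fun x => by ring)
  have hB : 0 ≤ ∫ x, v x ^ 2 ∂μ := integral_nonneg fun x => sq_nonneg _
  set A := ∫ x, w x * v x ∂μ
  set B := ∫ x, v x ^ 2 ∂μ
  have key := h (A / (B + 1))
  rw [expand] at key
  have hB1 : 0 < B + 1 := by linarith
  have e : -(2 * (A / (B + 1)) * A) + (A / (B + 1)) ^ 2 * B =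
      -(A ^ 2 * (B + 2) / (B + 1) ^ 2) := by
    field_simp
    ring
  have h0 : A ^ 2 * (B + 2) / (B + 1) ^ 2 ≤ 0 := by linarith
  have h1 : A ^ 2 * (B + 2) ≤ 0 := by
    by_contra! hc
    exact absurd h0 (not_le.2 (by positivity))
  have h2 : A ^ 2 = 0 := by nlinarith [sq_nonneg A]
  exact pow_eq_zero_iff two_ne_zero |>.1 h2

theorem hausdorffMeasure_one_restrict_segment {E : Type*} [NormedAddCommGroup E]
    [NormedSpace ℝ E] [MeasurableSpace E] [BorelSpace E] (x y : E) :
    (μH[1] : Measure E).restrict (segment ℝ x y) = nndist x y •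
      (volume.restrict (Icc (0 : ℝ) 1)).map (AffineMap.lineMap x y : ℝ → E) := by
  have hc : Continuous (AffineMap.lineMap x y : ℝ → E) := AffineMap.lineMap_continuous
  ext A hA
  rw [Measure.restrict_apply hA, Measure.smul_apply, Measure.map_apply hc.measurable hA,
    Measure.restrict_apply (hc.measurable hA), ← hausdorffMeasure_real,
    ← hausdorffMeasure_lineMap_image, segment_eq_image_lineMap, image_preimage_inter]

theorem setIntegral_segment_hausdorffMeasure {E : Type*} [NormedAddCommGroup E]
    [NormedSpace ℝ E] [MeasurableSpace E] [BorelSpace E] {x y : E} (hxy : x ≠ y) (f : E → ℝ) :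
    ∫ z in segment ℝ x y, f z ∂μH[1] =
      dist x y * ∫ t in Icc (0 : ℝ) 1, f (AffineMap.lineMap x y t) := by
  have hemb : MeasurableEmbedding (AffineMap.lineMap x y : ℝ → E) :=
    AffineMap.lineMap_continuous.measurableEmbedding (AffineMap.lineMap_injective ℝ hxy)
  rw [hausdorffMeasure_one_restrict_segment x y, integral_smul_nnreal_measure,
    hemb.integral_map]
  rfl

theorem continuousOn_comp_lineMap {E : Type*} [NormedAddCommGroup E] [NormedSpace ℝ E]
    {x y : E} {u : E → ℝ} (hu : ContinuousOn u (segment ℝ x y)) :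
    ContinuousOn (fun t : ℝ => u (AffineMap.lineMap x y t)) (Icc 0 1) := by
  have hγ : Continuous (AffineMap.lineMap x y : ℝ → E) := AffineMap.lineMap_continuous
  refine hu.comp hγ.continuousOn fun t ht => ?_
  rw [segment_eq_image_lineMap]
  exact mem_image_of_mem _ ht

/-- The value at the endpoint `x` of the `L²`-best affine approximation of `u` on a segment. -/
theorem apply_left_eq_of_forall_setIntegral_segment_sq_le {E : Type*} [NormedAddCommGroup E]
    [InnerProductSpace ℝ E] [MeasurableSpace E] [BorelSpace E] {x y : E} (hxy : x ≠ y)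
    {u : E → ℝ} (hu : ContinuousOn u (segment ℝ x y)) (g : E →ᵃ[ℝ] ℝ)
    (hg : ∀ g' : E →ᵃ[ℝ] ℝ, ∫ z in segment ℝ x y, (u z - g z) ^ 2 ∂μH[1] ≤
      ∫ z in segment ℝ x y, (u z - g' z) ^ 2 ∂μH[1]) :
    g x = ∫ t in Icc (0 : ℝ) 1, (4 - 6 * t) * u (AffineMap.lineMap x y t) := by
  set γ : ℝ → E := ⇑(AffineMap.lineMap x y : ℝ →ᵃ[ℝ] E) with hγ
  have hw0 : (inner ℝ (y - x) (y - x) : ℝ) ≠ 0 := by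
    simpa [sub_eq_zero] using hxy.symm
  let v : E →ᵃ[ℝ] ℝ := AffineMap.const ℝ E 4 -
    (6 / (inner ℝ (y - x) (y - x) : ℝ)) •
      ((innerₗ E (y - x)).toAffineMap - AffineMap.const ℝ E (inner ℝ (y - x) x))
  have hv (t : ℝ) : v (γ t) = 4 - 6 * t := by
    simp only [v, hγ, AffineMap.lineMap_apply_module', AffineMap.coe_sub, AffineMap.coe_smul,
      AffineMap.coe_const, Pi.sub_apply, Pi.smul_apply, Function.const_apply,
      LinearMap.coe_toAffineMap, innerₗ_apply_apply, inner_add_right, inner_smul_right, smul_eq_mul]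
    field_simp
    ring
  have hgγ (t : ℝ) : g (γ t) = g x + t * (g y - g x) := by
    rw [hγ, AffineMap.apply_lineMap, AffineMap.lineMap_apply_module']
    simp [add_comm]
  have huγ : ContinuousOn (fun t => u (γ t)) (Icc 0 1) := continuousOn_comp_lineMap hu
  have hwc : ContinuousOn (fun t => u (γ t) - (g x + t * (g y - g x))) (Icc 0 1) :=
    huγ.sub (by fun_prop)
  have hvc : ContinuousOn (fun t : ℝ => 4 - 6 * t) (Icc 0 1) := by fun_prop
  have hdist : 0 < dist x y := dist_pos.2 hxy
  have orth : ∫ t in Icc (0 : ℝ) 1, (u (γ t) - (g x + t * (g y - g x))) * (4 - 6 * t) = 0 := by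
    refine integral_mul_eq_zero_of_forall_integral_sq_le
      (hwc.pow 2).integrableOn_Icc (hwc.mul hvc).integrableOn_Icc (hvc.pow 2).integrableOn_Icc
      fun ε => ?_
    have := hg (g + ε • v)
    rw [setIntegral_segment_hausdorffMeasure hxy, setIntegral_segment_hausdorffMeasure hxy] at this
    have := le_of_mul_le_mul_left this hdist
    change ∫ t in Icc (0 : ℝ) 1, (u (γ t) - g (γ t)) ^ 2 ≤
      ∫ t in Icc (0 : ℝ) 1, (u (γ t) - (g (γ t) + ε * v (γ t))) ^ 2 at this
    simp only [hv, hgγ] at this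
    simpa only [sub_sub] using this
  have hpoly : ∫ t in Icc (0 : ℝ) 1, (g x + t * (g y - g x)) * (4 - 6 * t) = g x := by
    rw [integral_Icc_eq_integral_Ioc, ← intervalIntegral.integral_of_le zero_le_one]
    set a := g x
    set b := g y - g x
    have hd (t : ℝ) (_ : t ∈ uIcc (0 : ℝ) 1) : HasDerivAt
        (fun t : ℝ => 4 * a * t + (2 * b - 3 * a) * t ^ 2 - 2 * b * t ^ 3)
        ((a + t * b) * (4 - 6 * t)) t := by
      have := (((hasDerivAt_id t).const_mul (4 * a)).add
        ((hasDerivAt_pow 2 t).const_mul (2 * b - 3 * a))).sub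
        ((hasDerivAt_pow 3 t).const_mul (2 * b))
      refine this.congr_deriv ?_
      push_cast
      ring
    rw [intervalIntegral.integral_eq_sub_of_hasDerivAt hd
      (Continuous.intervalIntegrable (by fun_prop) _ _)]
    ring
  have hsub := integral_sub (μ := volume.restrict (Icc (0 : ℝ) 1))
    (huγ.mul hvc).integrableOn_Icc
    (f := fun t => u (γ t) * (4 - 6 * t))
    (g := fun t => (g x + t * (g y - g x)) * (4 - 6 * t))
    (ContinuousOn.integrableOn_Icc (by fun_prop))
  simp only [← sub_mul] at hsub
  rw [orth, hpoly] at hsub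
  have hcomm (t : ℝ) : (4 - 6 * t) * u (γ t) = u (γ t) * (4 - 6 * t) := mul_comm _ _
  simp only [hcomm]
  linarith

/-- Integrating over the image of `D` under a map with a nonexpansive left inverse. -/
theorem setIntegral_comp_le_setIntegral_hausdorffMeasure {E : Type*} [MetricSpace E]
    [MeasurableSpace E] [BorelSpace E] {P : E → ℝ × ℝ} {Ψ : ℝ × ℝ → E} {D : Set (ℝ × ℝ)}
    {F : Set E} (hP : LipschitzWith 1 P) (hΨ : Measurable Ψ) (hmaps : MapsTo Ψ D F)
    (hinv : LeftInvOn P Ψ D) {f : E → ℝ} (hf0 : ∀ x, 0 ≤ f x)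
    (hf : IntegrableOn f F μH[2]) :
    ∫ z in D, f (Ψ z) ≤ ∫ x in F, f x ∂μH[2] := by
  have hle : (volume.restrict D).map Ψ ≤ (μH[2] : Measure E).restrict F := by
    refine Measure.le_iff.2 fun A hA => ?_
    rw [Measure.map_apply hΨ hA, Measure.restrict_apply (hΨ hA), Measure.restrict_apply hA,
      ← hausdorffMeasure_prod_real]
    calc μH[2] (Ψ ⁻¹' A ∩ D) ≤ μH[2] (P '' (A ∩ F)) :=
          measure_mono fun z hz => ⟨Ψ z, ⟨hz.1, hmaps hz.2⟩, hinv hz.2⟩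
      _ ≤ μH[2] (A ∩ F) := by
          simpa using hP.hausdorffMeasure_image_le (d := 2) (by norm_num) (A ∩ F)
  rw [← integral_map hΨ.aemeasurable (hf.aestronglyMeasurable.mono_measure hle)]
  exact integral_mono_measure hle (.of_forall hf0) hf

/-- The vertical increments of `u` across a trapezoid with two vertical sides are controlled by
the integral of the vertical derivative over the trapezoid. -/
theorem mul_setIntegral_abs_sub_le_setIntegral_trapezoid {q a : EuclideanSpace ℝ (Fin 3)}
    {h k L : ℝ} (hh : 0 < h) (hk : 0 < k) (hL0 : 0 < L)
    (hL : L ^ 2 = (a 0 - q 0) ^ 2 + (a 1 - q 1) ^ 2)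
    {e : EuclideanSpace ℝ (Fin 3)} (he : e = EuclideanSpace.single 2 1)
    {F : Set (EuclideanSpace ℝ (Fin 3))}
    (hF : F = convexHull ℝ (segment ℝ q a ∪ segment ℝ (q + h • e) (a + k • e)))
    {u : EuclideanSpace ℝ (Fin 3) → ℝ} {U : Set (EuclideanSpace ℝ (Fin 3))} (hU : IsOpen U)
    (hFU : F ⊆ U) (hu : ContDiffOn ℝ 1 u U) :
    L * ∫ t in Icc (0 : ℝ) 1, |u (AffineMap.lineMap (q + h • e) (a + k • e) t) -
        u (AffineMap.lineMap q a t)| ≤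
      ∫ x in F, |fderiv ℝ u x e| ∂μH[2] := by
  have he0 : e 0 = 0 := by simp [he]
  have he1 : e 1 = 0 := by simp [he]
  have he2 : e 2 = 1 := by simp [he]
  let Λ : ℝ × ℝ →L[ℝ] EuclideanSpace ℝ (Fin 3) :=
    (ContinuousLinearMap.fst ℝ ℝ ℝ).smulRight (L⁻¹ • (a - q - (a 2 - q 2) • e)) +
      (ContinuousLinearMap.snd ℝ ℝ ℝ).smulRight e
  let Ψ : ℝ × ℝ →ᵃ[ℝ] EuclideanSpace ℝ (Fin 3) :=
    (Λ : ℝ × ℝ →ₗ[ℝ] EuclideanSpace ℝ (Fin 3)).toAffineMap + AffineMap.const ℝ _ (q - q 2 • e)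
  have hΨ (z : ℝ × ℝ) : Ψ z = z.1 • (L⁻¹ • (a - q - (a 2 - q 2) • e)) + z.2 • e +
      (q - q 2 • e) := rfl
  have hΨ0 (z : ℝ × ℝ) : Ψ z 0 = q 0 + z.1 / L * (a 0 - q 0) := by
    simp [hΨ, he0]; ring
  have hΨ1 (z : ℝ × ℝ) : Ψ z 1 = q 1 + z.1 / L * (a 1 - q 1) := by
    simp [hΨ, he1]; ring
  have hΨ2 (z : ℝ × ℝ) : Ψ z 2 = z.2 := by
    simp [hΨ, he2]
  have hΨlip : LipschitzWith ‖Λ‖₊ Ψ := by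
    refine LipschitzWith.of_dist_le_mul fun x y => ?_
    have := Λ.lipschitz.dist_le_mul x y
    simpa [Ψ] using this
  let P : EuclideanSpace ℝ (Fin 3) → ℝ × ℝ := fun x =>
    (L⁻¹ * ((a 0 - q 0) * (x 0 - q 0) + (a 1 - q 1) * (x 1 - q 1)), x 2)
  have hP : LipschitzWith 1 P := by
    refine LipschitzWith.of_dist_le_mul fun x y => ?_
    rw [NNReal.coe_one, one_mul, Prod.dist_eq, EuclideanSpace.dist_eq, Fin.sum_univ_three]
    simp only [P, Real.dist_eq, sq_abs]
    refine max_le (Real.le_sqrt_of_sq_le ?_) (Real.le_sqrt_of_sq_le ?_)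
    · rw [sq_abs, ← mul_sub, mul_pow, inv_pow, inv_mul_le_iff₀ (by positivity), hL]
      nlinarith [sq_nonneg ((a 0 - q 0) * (x 1 - y 1) - (a 1 - q 1) * (x 0 - y 0)),
        mul_nonneg (sq_nonneg (a 0 - q 0)) (sq_nonneg (x 2 - y 2)),
        mul_nonneg (sq_nonneg (a 1 - q 1)) (sq_nonneg (x 2 - y 2))]
    · rw [sq_abs]
      nlinarith [sq_nonneg (x 0 - y 0), sq_nonneg (x 1 - y 1)]
  have hPΨ (z : ℝ × ℝ) : P (Ψ z) = z := by
    refine Prod.ext ?_ (hΨ2 z)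
    simp only [P, hΨ0, hΨ1]
    field_simp
    linear_combination (-z.1) * hL
  have hlow (t : ℝ) : AffineMap.lineMap q a t = Ψ (L * t, q 2 + t * (a 2 - q 2)) := by
    rw [AffineMap.lineMap_apply_module']
    ext i
    fin_cases i
    · simp [hΨ0, hL0.ne']; ring
    · simp [hΨ1, hL0.ne']; ring
    · simp [hΨ2]; ring
  have hupp (t : ℝ) : AffineMap.lineMap (q + h • e) (a + k • e) t =
      Ψ (L * t, q 2 + t * (a 2 - q 2) + (h + t * (k - h))) := by
    rw [AffineMap.lineMap_apply_module']
    ext i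
    fin_cases i
    · simp [hΨ0, hL0.ne', he0]; ring
    · simp [hΨ1, hL0.ne', he1]; ring
    · simp [hΨ2, he2]; ring
  have hH {t : ℝ} (ht : t ∈ Icc (0 : ℝ) 1) : 0 < h + t * (k - h) := by
    rcases ht.1.eq_or_lt with rfl | h0
    · simpa
    · nlinarith [mul_pos h0 hk, mul_nonneg (sub_nonneg.2 ht.2) hh.le]
  let D : Set (ℝ × ℝ) := {z | z.1 / L ∈ Icc (0 : ℝ) 1 ∧
    z.2 ∈ Icc (q 2 + z.1 / L * (a 2 - q 2))
      (q 2 + z.1 / L * (a 2 - q 2) + (h + z.1 / L * (k - h)))}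
  have hD (t y : ℝ) : (L * t, y) ∈ D ↔ t ∈ Icc (0 : ℝ) 1 ∧
      y ∈ Icc (q 2 + t * (a 2 - q 2)) (q 2 + t * (a 2 - q 2) + (h + t * (k - h))) := by
    simp [D, hL0.ne']
  have hDconv : Convex ℝ D := by
    rintro ⟨x₁, x₂⟩ ⟨⟨h1, h2⟩, h3, h4⟩ ⟨y₁, y₂⟩ ⟨⟨h1', h2'⟩, h3', h4'⟩ c d hc hd hcd
    have hcomb : (c * x₁ + d * y₁) / L = c * (x₁ / L) + d * (y₁ / L) := by ring
    obtain rfl : d = 1 - c := by linarith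
    simp only [D, mem_ofPred_eq, mem_Icc, Prod.smul_mk, Prod.mk_add_mk, smul_eq_mul, hcomb] at *
    refine ⟨⟨?_, ?_⟩, ?_, ?_⟩ <;> nlinarith
  have hFD : F = Ψ '' D := by
    rw [hF]
    refine (convexHull_min ?_ (hDconv.affine_image Ψ)).antisymm ?_
    · rw [segment_eq_image_lineMap, segment_eq_image_lineMap]
      rintro _ (⟨t, ht, rfl⟩ | ⟨t, ht, rfl⟩)
      · exact ⟨_, (hD _ _).2 ⟨ht, left_mem_Icc.2 (by linarith [hH ht])⟩, (hlow t).symm⟩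
      · exact ⟨_, (hD _ _).2 ⟨ht, right_mem_Icc.2 (by linarith [hH ht])⟩, (hupp t).symm⟩
    · rintro _ ⟨⟨τ, y⟩, hz, rfl⟩
      obtain ⟨t, rfl⟩ : ∃ t, τ = L * t := ⟨τ / L, by field_simp⟩
      obtain ⟨ht, hy⟩ := (hD _ _).1 hz
      have h1 : Ψ (L * t, q 2 + t * (a 2 - q 2)) ∈
          convexHull ℝ (segment ℝ q a ∪ segment ℝ (q + h • e) (a + k • e)) := by
        rw [← hlow, segment_eq_image_lineMap]
        exact subset_convexHull ℝ _ (.inl (mem_image_of_mem _ ht))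
      have h2 : Ψ (L * t, q 2 + t * (a 2 - q 2) + (h + t * (k - h))) ∈
          convexHull ℝ (segment ℝ q a ∪ segment ℝ (q + h • e) (a + k • e)) := by
        rw [← hupp, segment_eq_image_lineMap ℝ (q + h • e)]
        exact subset_convexHull ℝ _ (.inr (mem_image_of_mem _ ht))
      have hconv := (convex_convexHull ℝ
        (segment ℝ q a ∪ segment ℝ (q + h • e) (a + k • e))).affine_preimage Ψ
      refine hconv.segment_subset h1 h2 ?_
      have hHt := hH ht
      refine ⟨1 - (y - (q 2 + t * (a 2 - q 2))) / (h + t * (k - h)),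
        (y - (q 2 + t * (a 2 - q 2))) / (h + t * (k - h)), ?_, ?_, by ring, ?_⟩
      · rw [sub_nonneg, div_le_one hHt]
        linarith [hy.2]
      · exact div_nonneg (by linarith [hy.1]) hHt.le
      · ext
        · simp
          ring
        · simp
          field_simp
          ring
  have hFc : IsCompact F := by
    rw [hF, ← convexHull_pair, ← convexHull_pair, convexHull_convexHull_union_left,
      convexHull_convexHull_union_right]
    exact ((toFinite _).union (toFinite _)).isCompact_convexHull ℝ
  have hDc : IsCompact D := by
    have hDP : D = P '' F := by
      rw [hFD, LeftInvOn.image_image fun z _ => hPΨ z]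
    exact hDP ▸ hFc.image hP.continuous
  have hmaps : MapsTo Ψ D F := hFD ▸ mapsTo_image Ψ D
  have hfd : ContinuousOn (fun x => fderiv ℝ u x e) F :=
    ((hu.continuousOn_fderiv_of_isOpen hU le_rfl).mono hFU).clm_apply continuousOn_const
  have hFfin : (μH[2] : Measure (EuclideanSpace ℝ (Fin 3))) F < ⊤ := by
    rw [hFD]
    refine (hΨlip.hausdorffMeasure_image_le (d := 2) (by norm_num) D).trans_lt ?_
    rw [hausdorffMeasure_prod_real]
    exact ENNReal.mul_lt_top (by simp) hDc.measure_lt_top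
  have hint : IntegrableOn (fun x => |fderiv ℝ u x e|) F μH[2] := by
    obtain ⟨C, hC⟩ := hFc.exists_bound_of_continuousOn hfd.abs
    exact IntegrableOn.of_bound hFfin (hfd.abs.aestronglyMeasurable hFc.measurableSet) C
      ((ae_restrict_iff' hFc.measurableSet).2 (.of_forall hC))
  refine le_trans ?_ (setIntegral_comp_le_setIntegral_hausdorffMeasure hP
    hΨlip.continuous.measurable hmaps (fun z _ => hPΨ z) (fun _ => abs_nonneg _) hint)
  set G : ℝ × ℝ → ℝ := fun z => fderiv ℝ u (Ψ z) e with hG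
  have hGc : ContinuousOn G D := hfd.comp hΨlip.continuous.continuousOn hmaps
  have hind : Integrable (D.indicator fun z => |G z|) (volume.prod volume) :=
    (integrable_indicator_iff hDc.measurableSet).2 (hGc.abs.integrableOn_compact hDc)
  set I : ℝ → ℝ := fun τ => ∫ y, D.indicator (fun z => |G z|) (τ, y) with hI
  have hIint : Integrable I := hind.integral_prod_left
  have hI0 (τ : ℝ) : 0 ≤ I τ := integral_nonneg fun y =>
    indicator_nonneg (fun _ _ => abs_nonneg _) _
  have hDI : ∫ z in D, |G z| = ∫ τ, I τ := by
    rw [← integral_indicator hDc.measurableSet, Measure.volume_eq_prod, integral_prod _ hind]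
  have hbound (t : ℝ) (ht : t ∈ Icc (0 : ℝ) 1) :
      |u (AffineMap.lineMap (q + h • e) (a + k • e) t) - u (AffineMap.lineMap q a t)| ≤
        I (L * t) := by
    have hHt := hH ht
    rw [hlow, hupp]
    set m := q 2 + t * (a 2 - q 2)
    set M := m + (h + t * (k - h))
    have hmM : m ≤ M := by simp only [M]; linarith
    have hIt : I (L * t) = ∫ y in m..M, |G (L * t, y)| := by
      rw [intervalIntegral.integral_of_le hmM, ← integral_Icc_eq_integral_Ioc,
        ← integral_indicator measurableSet_Icc]
      refine integral_congr_ae (.of_forall fun y => ?_)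
      by_cases hy : y ∈ Icc m M
      · simp only [indicator_of_mem hy, indicator_of_mem ((hD t y).2 ⟨ht, hy⟩)]
      · simp only [indicator_of_notMem hy, indicator_of_notMem fun hz => hy ((hD t y).1 hz).2]
    have hderiv (y : ℝ) (hy : y ∈ uIcc m M) :
        HasDerivAt (fun y => u (Ψ (L * t, y))) (G (L * t, y)) y := by
      rw [uIcc_of_le hmM] at hy
      have hzU := hFU (hmaps ((hD t y).2 ⟨ht, hy⟩))
      have hdu := ((hu.differentiableOn one_ne_zero).differentiableAt (hU.mem_nhds hzU)).hasFDerivAt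
      refine hdu.comp_hasDerivAt y ?_
      simp only [hΨ]
      simpa using (((hasDerivAt_id y).smul_const e).const_add
        ((L * t) • (L⁻¹ • (a - q - (a 2 - q 2) • e)))).add_const (q - q 2 • e)
    have hGi : IntervalIntegrable (fun y => G (L * t, y)) volume m M := by
      refine ContinuousOn.intervalIntegrable ?_
      rw [uIcc_of_le hmM]
      exact hGc.comp (by fun_prop) fun y hy => (hD t y).2 ⟨ht, hy⟩
    rw [hIt, ← intervalIntegral.integral_eq_sub_of_hasDerivAt hderiv hGi]
    exact intervalIntegral.abs_integral_le_integral_abs hmM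
  have hle : ∫ t in Icc (0 : ℝ) 1, |u (AffineMap.lineMap (q + h • e) (a + k • e) t) -
      u (AffineMap.lineMap q a t)| ≤ ∫ t in Icc (0 : ℝ) 1, I (L * t) :=
    integral_mono_of_nonneg (.of_forall fun _ => abs_nonneg _)
      (hIint.comp_mul_left' hL0.ne').integrableOn
      ((ae_restrict_iff' measurableSet_Icc).2 (.of_forall hbound))
  calc _ ≤ L * ∫ t in Icc (0 : ℝ) 1, I (L * t) := mul_le_mul_of_nonneg_left hle hL0.le
    _ = ∫ τ in Icc (0 : ℝ) L, I τ := by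
        rw [integral_Icc_eq_integral_Ioc, integral_Icc_eq_integral_Ioc,
          ← intervalIntegral.integral_of_le zero_le_one, ← intervalIntegral.integral_of_le hL0.le]
        simp
    _ ≤ ∫ τ, I τ := setIntegral_le_integral hIint (.of_forall hI0)
    _ = ∫ z in D, |G z| := hDI.symm

/-- Stability of the quasi-interpolant in the direction of the
singular edge. With `p₁ = q`, `p₂ = q + h₃e₃`, `σ₁ = [p₁,a₁]`, `σ₂ = [p₂,a₂]`
(`a₂ = a₁ + k e₃`) having the same orthogonal projection of length `L` onto the
`x₁x₂`-plane, `F` the planar trapezoid between `σ₁` and `σ₂`, and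
`Du = Σᵢ (Π_{σᵢ}u)(pᵢ)λᵢ` the quasi-interpolant on a nondegenerate tetrahedron
`T = conv{p₁,p₂,p₃,p₄}`, the constant value of `∂₃(Du)` satisfies
`|∂₃(Du)| ≤ (4/(h₃L)) ∫_F |∂₃u| dH²`. -/
theorem quasi_interpolant_vertical_stability
    (q a₁ p₃ p₄ q₃ q₄ : EuclideanSpace ℝ (Fin 3))
    (h₃ k : ℝ) (hh₃ : 0 < h₃) (hk : 0 < k)
    (hproj : ¬(a₁ 0 = q 0 ∧ a₁ 1 = q 1))
    (p : Fin 4 → EuclideanSpace ℝ (Fin 3))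
    (hpdef : p = ![q, q + h₃ • EuclideanSpace.single 2 (1:ℝ), p₃, p₄])
    (s : Fin 4 → EuclideanSpace ℝ (Fin 3))
    (hsdef : s = ![a₁, a₁ + k • EuclideanSpace.single 2 (1:ℝ), q₃, q₄])
    (hp : AffineIndependent ℝ p)
    (hs : ∀ i, s i ≠ p i)
    (hseg₃ : segment ℝ (p 2) (s 2) ⊆ closure (convexHull ℝ (range p)))
    (hseg₄ : segment ℝ (p 3) (s 3) ⊆ closure (convexHull ℝ (range p)))
    (lam : Fin 4 → (EuclideanSpace ℝ (Fin 3) →ᵃ[ℝ] ℝ))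
    (hlam : ∀ i j, lam i (p j) = if i = j then 1 else 0)
    (L : ℝ) (hL : L = Real.sqrt ((a₁ 0 - q 0) ^ 2 + (a₁ 1 - q 1) ^ 2))
    (F : Set (EuclideanSpace ℝ (Fin 3)))
    (hF : F = convexHull ℝ (segment ℝ (p 0) (s 0) ∪ segment ℝ (p 1) (s 1)))
    (u : EuclideanSpace ℝ (Fin 3) → ℝ)
    (hu : ∃ U : Set (EuclideanSpace ℝ (Fin 3)), IsOpen U ∧
      (convexHull ℝ (range p) ∪ F) ⊆ U ∧ ContDiffOn ℝ 1 u U)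
    (g : Fin 4 → (EuclideanSpace ℝ (Fin 3) →ᵃ[ℝ] ℝ))
    (hg : ∀ i, ∀ g' : EuclideanSpace ℝ (Fin 3) →ᵃ[ℝ] ℝ,
      (∫ x in segment ℝ (p i) (s i), (u x - g i x) ^ 2 ∂μH[1]) ≤
        ∫ x in segment ℝ (p i) (s i), (u x - g' x) ^ 2 ∂μH[1]) :
    |∑ i : Fin 4, g i (p i) * (lam i).linear (EuclideanSpace.single 2 (1:ℝ))| ≤
      (4 / (h₃ * L)) *
        ∫ x in F, |fderiv ℝ u x (EuclideanSpace.single 2 (1:ℝ))| ∂μH[2] := by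
  obtain ⟨U, hU, hsub, hu⟩ := hu
  set e : EuclideanSpace ℝ (Fin 3) := EuclideanSpace.single 2 (1:ℝ) with he
  have hp0 : p 0 = q := by simp [hpdef]
  have hp1 : p 1 = q + h₃ • e := by simp [hpdef]
  have hs0 : s 0 = a₁ := by simp [hsdef]
  have hs1 : s 1 = a₁ + k • e := by simp [hsdef]
  have hLsq : L ^ 2 = (a₁ 0 - q 0) ^ 2 + (a₁ 1 - q 1) ^ 2 := by
    rw [hL, Real.sq_sqrt (by positivity)]
  have hL0 : 0 < L := by
    refine (hL ▸ Real.sqrt_nonneg _ : 0 ≤ L).lt_of_ne' fun h0 => hproj ?_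
    rw [h0] at hLsq
    constructor <;> nlinarith [sq_nonneg (a₁ 0 - q 0), sq_nonneg (a₁ 1 - q 1)]
  have hFU : F ⊆ U := subset_union_right.trans hsub
  have hlin (i : Fin 4) : h₃ * (lam i).linear e =
      (if i = 1 then 1 else 0) - if i = 0 then 1 else 0 := by
    rw [← hlam i 1, ← hlam i 0, hp0, hp1, ← smul_eq_mul, ← map_smul, add_comm, ← vadd_eq_add,
      AffineMap.map_vadd]
    simp
  have hcoef (i : Fin 4) : (lam i).linear e =
      ((if i = 1 then 1 else 0) - if i = 0 then 1 else 0) / h₃ := by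
    rw [← hlin, mul_div_cancel_left₀ _ hh₃.ne']
  have hsum : ∑ i : Fin 4, g i (p i) * (lam i).linear e = (g 1 (p 1) - g 0 (p 0)) / h₃ := by
    simp only [hcoef, Fin.sum_univ_four]
    simp
    ring
  have hc0 : ContinuousOn u (segment ℝ (p 0) (s 0)) :=
    hu.continuousOn.mono ((subset_union_left.trans (subset_convexHull ℝ _)).trans (hF ▸ hFU))
  have hc1 : ContinuousOn u (segment ℝ (p 1) (s 1)) :=
    hu.continuousOn.mono ((subset_union_right.trans (subset_convexHull ℝ _)).trans (hF ▸ hFU))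
  have hg0 := apply_left_eq_of_forall_setIntegral_segment_sq_le (hs 0).symm hc0 (g 0) (hg 0)
  have hg1 := apply_left_eq_of_forall_setIntegral_segment_sq_le (hs 1).symm hc1 (g 1) (hg 1)
  rw [hp0, hs0, hp1, hs1] at hF
  have hcore := mul_setIntegral_abs_sub_le_setIntegral_trapezoid hh₃ hk hL0 hLsq he hF hU hFU hu
  have hv0 := continuousOn_comp_lineMap hc0
  have hv1 := continuousOn_comp_lineMap hc1
  have hlin4 : ContinuousOn (fun t : ℝ => 4 - 6 * t) (Icc 0 1) := by fun_prop
  have hdiff : |g 1 (p 1) - g 0 (p 0)| ≤ 4 * ∫ t in Icc (0 : ℝ) 1,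
      |u (AffineMap.lineMap (p 1) (s 1) t) - u (AffineMap.lineMap (p 0) (s 0) t)| := by
    rw [hg0, hg1, ← integral_sub
      (f := fun t => (4 - 6 * t) * u (AffineMap.lineMap (p 1) (s 1) t))
      (g := fun t => (4 - 6 * t) * u (AffineMap.lineMap (p 0) (s 0) t))
      (hlin4.mul hv1).integrableOn_Icc (hlin4.mul hv0).integrableOn_Icc, ← integral_const_mul]
    refine abs_integral_le_integral_abs.trans (setIntegral_mono_on ?_ ?_ measurableSet_Icc ?_)
    · exact ((hlin4.mul hv1).sub (hlin4.mul hv0)).abs.integrableOn_Icc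
    · exact (continuousOn_const.mul (hv1.sub hv0).abs).integrableOn_Icc
    · intro t ht
      rw [← mul_sub, abs_mul]
      refine mul_le_mul_of_nonneg_right ?_ (abs_nonneg _)
      rw [abs_le]
      constructor <;> linarith [ht.1, ht.2]
  rw [hsum, abs_div, abs_of_pos hh₃, div_mul_eq_mul_div, div_le_div_iff₀ hh₃ (by positivity)]
  rw [hp1, hs1, hp0, hs0] at hdiff
  rw [hp1, hp0]
  nlinarith [mul_le_mul_of_nonneg_left hdiff (mul_pos hh₃ hL0).le,
    mul_le_mul_of_nonneg_left hcore hh₃.le]
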